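/- arXiv:physics/0508173 — 2 statements merged into one kernel-verified Lean document; each statement's English description precedes it below -/
import Mathlib

section
/- Let α be a real number, let B_s : ℝ³ → ℝ³ be a smooth vector field, and set B = (1−α²Δ)B_s. Then at every point of ℝ³, (∇B)ᵀ·B_s − ∇( ½(1−α²Δ)|B_s|² + (α²/2)|∇B_s|² ) = α² div( (∇B_s)ᵀ·∇B_s ). -/
open Matrix MeasureTheory

noncomputable section

abbrev V3 := Fin 3 → ℝ

/-- Partial derivative `∂_j f` of a scalar field on ℝ³. -/
def pd (j : Fin 3) (f : V3 → ℝ) (x : V3) : ℝ := fderiv ℝ f x (Pi.single j 1)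

/-- Jacobian matrix field: `(∇f)_{ij} = ∂f_i/∂x_j`. -/
def grad (f : V3 → V3) (x : V3) : Matrix (Fin 3) (Fin 3) ℝ :=
  Matrix.of fun i j => pd j (fun y => f y i) x

/-- Divergence of a vector field. -/
def divV (f : V3 → V3) (x : V3) : ℝ := ∑ j, pd j (fun y => f y j) x

/-- Divergence of a matrix field: `(div M)_i = Σ_j ∂_j M_{ij}`. -/
def divM (M : V3 → Matrix (Fin 3) (Fin 3) ℝ) (x : V3) (i : Fin 3) : ℝ :=
  ∑ j, pd j (fun y => M y i j) x

/-- Scalar Laplacian. -/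
def lapS (φ : V3 → ℝ) (x : V3) : ℝ := ∑ j, pd j (fun y => pd j φ y) x

/-- Componentwise Laplacian of a vector field. -/
def lap (f : V3 → V3) (x : V3) (i : Fin 3) : ℝ := lapS (fun y => f y i) x

/-- Helmholtz operator `(1 - α²Δ)` on vector fields. -/
def helm (α : ℝ) (f : V3 → V3) (x : V3) (i : Fin 3) : ℝ := f x i - α ^ 2 * lap f x i

/-- Helmholtz operator `(1 - α²Δ)` on scalar fields. -/
def helmS (α : ℝ) (φ : V3 → ℝ) (x : V3) : ℝ := φ x - α ^ 2 * lapS φ x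

/-- Advection `(g·∇)f = Σ_j g_j ∂_j f`. -/
def advect (g f : V3 → V3) (x : V3) (i : Fin 3) : ℝ :=
  ∑ j, g x j * pd j (fun y => f y i) x

/-- `(∇f)ᵀ·g`, pointwise matrix-vector product. -/
def gradTvec (f g : V3 → V3) (x : V3) (i : Fin 3) : ℝ :=
  ∑ j, (grad f x)ᵀ i j * g x j

/-- Gradient of a scalar field. -/
def gradS (φ : V3 → ℝ) (x : V3) (i : Fin 3) : ℝ := pd i φ x

/-- Pointwise squared Euclidean norm `|f|²`. -/
def normSq (f : V3 → V3) (x : V3) : ℝ := ∑ i, (f x i) ^ 2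

/-- Squared Frobenius norm of the Jacobian, `|∇f|²`. -/
def gradNormSq (f : V3 → V3) (x : V3) : ℝ := ∑ i, ∑ j, (grad f x i j) ^ 2

lemma pd_sub {f g : V3 → ℝ} {x : V3} (hf : DifferentiableAt ℝ f x) (hg : DifferentiableAt ℝ g x)
    (j : Fin 3) : pd j (fun y => f y - g y) x = pd j f x - pd j g x := by
  simp [pd, fderiv_fun_sub hf hg]

lemma pd_mul {f g : V3 → ℝ} {x : V3} (hf : DifferentiableAt ℝ f x) (hg : DifferentiableAt ℝ g x)
    (j : Fin 3) : pd j (fun y => f y * g y) x = f x * pd j g x + g x * pd j f x := by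
  simp [pd, fderiv_fun_mul hf hg]

lemma pd_const_mul {f : V3 → ℝ} {x : V3} (hf : DifferentiableAt ℝ f x) (c : ℝ)
    (j : Fin 3) : pd j (fun y => c * f y) x = c * pd j f x := by
  simp [pd, fderiv_const_mul hf]

lemma pd_sq {f : V3 → ℝ} {x : V3} (hf : DifferentiableAt ℝ f x) (j : Fin 3) :
    pd j (fun y => f y ^ 2) x = 2 * (f x * pd j f x) := by
  simp only [pow_two]
  rw [pd_mul hf hf]
  ring

lemma pd_sum {ι : Type*} [Fintype ι] {f : ι → V3 → ℝ} {x : V3}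
    (hf : ∀ k, DifferentiableAt ℝ (f k) x) (j : Fin 3) :
    pd j (fun y => ∑ k, f k y) x = ∑ k, pd j (f k) x := by
  simp [pd, fderiv_fun_sum fun k _ => hf k]

lemma contDiff_pd {f : V3 → ℝ} (hf : ContDiff ℝ (⊤ : ℕ∞) f) (j : Fin 3) :
    ContDiff ℝ (⊤ : ℕ∞) (fun y => pd j f y) :=
  (hf.fderiv_right (m := (⊤ : ℕ∞)) (by simp)).clm_apply contDiff_const

lemma contDiff_lapS {f : V3 → ℝ} (hf : ContDiff ℝ (⊤ : ℕ∞) f) :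
    ContDiff ℝ (⊤ : ℕ∞) (fun y => lapS f y) :=
  ContDiff.sum fun j _ => contDiff_pd (contDiff_pd hf j) j

lemma differentiableAt_of_smooth {f : V3 → ℝ} (hf : ContDiff ℝ (⊤ : ℕ∞) f) (x : V3) :
    DifferentiableAt ℝ f x :=
  hf.differentiable (by simp) x

lemma pd_comm {f : V3 → ℝ} (hf : ContDiff ℝ (⊤ : ℕ∞) f) (i j : Fin 3) (x : V3) :
    pd i (fun y => pd j f y) x = pd j (fun y => pd i f y) x := by
  have hd : DifferentiableAt ℝ (fderiv ℝ f) x :=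
    (hf.fderiv_right (m := (⊤ : ℕ∞)) (by simp)).differentiable (by simp) x
  have hs : IsSymmSndFDerivAt ℝ f x :=
    hf.contDiffAt.isSymmSndFDerivAt (by
      rw [minSmoothness_of_isRCLikeNormedField]
      exact WithTop.coe_le_coe.mpr (le_top : (2 : ℕ∞) ≤ ⊤))
  have key : ∀ k l : Fin 3, pd k (fun y => pd l f y) x
      = fderiv ℝ (fderiv ℝ f) x (Pi.single k 1) (Pi.single l 1) := by
    intro k l
    simp [pd, fderiv_clm_apply hd (differentiableAt_const _)]
  rw [key, key, hs.eq]

lemma lapS_sq {f : V3 → ℝ} (hf : ContDiff ℝ (⊤ : ℕ∞) f) (x : V3) :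
    lapS (fun y => f y ^ 2) x = 2 * (f x * lapS f x + ∑ j, pd j f x ^ 2) := by
  have h := differentiableAt_of_smooth hf
  have h' := fun j => differentiableAt_of_smooth (contDiff_pd hf j)
  simp only [lapS, pd_sq (h _), Finset.mul_sum, ← Finset.sum_add_distrib]
  refine Finset.sum_congr rfl fun j _ => ?_
  rw [pd_const_mul ((h x).fun_mul (h' j x)), pd_mul (h x) (h' j x)]
  ring

lemma lapS_sum {ι : Type*} [Fintype ι] {f : ι → V3 → ℝ}
    (hf : ∀ k, ContDiff ℝ (⊤ : ℕ∞) (f k)) (x : V3) :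
    lapS (fun y => ∑ k, f k y) x = ∑ k, lapS (f k) x := by
  simp only [lapS]
  rw [Finset.sum_comm]
  refine Finset.sum_congr rfl fun j _ => ?_
  simp only [pd_sum fun k => differentiableAt_of_smooth (hf k) _]
  exact pd_sum (fun k => differentiableAt_of_smooth (contDiff_pd (hf k) j) x) j

/-- The scalar form of the identity, satisfied by each component of the vector field. -/
lemma pd_helmS_mul_sub (α : ℝ) {u : V3 → ℝ} (hu : ContDiff ℝ (⊤ : ℕ∞) u) (x : V3) (i : Fin 3) :
    pd i (fun y => u y - α ^ 2 * lapS u y) x * u x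
        - pd i (fun y => (1 / 2) * (u y ^ 2 - α ^ 2 * lapS (fun z => u z ^ 2) y)
            + (α ^ 2 / 2) * ∑ j, pd j u y ^ 2) x
      = α ^ 2 * ∑ j, pd j (fun y => pd i u y * pd j u y) x := by
  have h := differentiableAt_of_smooth hu x
  have h₁ := fun j => differentiableAt_of_smooth (contDiff_pd hu j) x
  have hl := differentiableAt_of_smooth (contDiff_lapS hu) x
  have hsq : DifferentiableAt ℝ (fun y => ∑ j, pd j u y ^ 2) x :=
    DifferentiableAt.fun_sum fun j _ => (h₁ j).fun_pow 2
  have hrw : (fun y => (1 / 2) * (u y ^ 2 - α ^ 2 * lapS (fun z => u z ^ 2) y)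
            + (α ^ 2 / 2) * ∑ j, pd j u y ^ 2)
      = fun y => ((1 / 2) * u y ^ 2 - α ^ 2 * (u y * lapS u y))
            - (α ^ 2 / 2) * ∑ j, pd j u y ^ 2 := by
    funext y
    rw [lapS_sq hu]
    ring
  have hdiv : ∑ j, pd j (fun y => pd i u y * pd j u y) x
      = pd i u x * lapS u x + ∑ j, pd j u x * pd i (fun y => pd j u y) x := by
    simp only [lapS, Finset.mul_sum, ← Finset.sum_add_distrib]
    refine Finset.sum_congr rfl fun j _ => ?_
    rw [pd_mul (h₁ i) (h₁ j), pd_comm hu i j]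
  have hu2 := (h.fun_pow 2).const_mul (1 / 2)
  have hul := h.fun_mul hl
  rw [hrw, hdiv, pd_sub h (hl.const_mul _), pd_const_mul hl,
    pd_sub (hu2.fun_sub (hul.const_mul _)) (hsq.const_mul _), pd_sub hu2 (hul.const_mul _),
    pd_const_mul (h.fun_pow 2), pd_const_mul hul, pd_const_mul hsq, pd_sq h, pd_mul h hl,
    pd_sum fun j => (h₁ j).fun_pow 2]
  simp only [pd_sq (h₁ _), ← Finset.mul_sum]
  ring

/-- the identity
`(∇B)ᵀ·B_s − ∇(½(1−α²Δ)|B_s|² + (α²/2)|∇B_s|²) = α² div((∇B_s)ᵀ·∇B_s)` with `B = (1−α²Δ)B_s`. -/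
theorem gradT_identity_magnetic (α : ℝ) (Bs : V3 → V3) (hBs : ContDiff ℝ (⊤ : ℕ∞) Bs) :
    ∀ x : V3, ∀ i : Fin 3,
      gradTvec (helm α Bs) Bs x i
          - gradS (fun y => (1 / 2) * helmS α (normSq Bs) y
              + (α ^ 2 / 2) * gradNormSq Bs y) x i
        = α ^ 2 * divM (fun y => (grad Bs y)ᵀ * grad Bs y) x i := by
  intro x i
  have hu : ∀ k, ContDiff ℝ (⊤ : ℕ∞) (fun y => Bs y k) := contDiff_pi.mp hBs
  have hu2 : ∀ k, ContDiff ℝ (⊤ : ℕ∞) (fun y => Bs y k ^ 2) := fun k => (hu k).pow 2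
  have hpotential : (fun y => (1 / 2) * helmS α (normSq Bs) y + (α ^ 2 / 2) * gradNormSq Bs y)
      = fun y => ∑ k, ((1 / 2) * (Bs y k ^ 2 - α ^ 2 * lapS (fun z => Bs z k ^ 2) y)
            + (α ^ 2 / 2) * ∑ j, pd j (fun z => Bs z k) y ^ 2) := by
    funext y
    have hlap : lapS (normSq Bs) y = ∑ k, lapS (fun z => Bs z k ^ 2) y := lapS_sum hu2 y
    simp only [helmS, hlap, normSq, gradNormSq, grad, Matrix.of_apply, Finset.sum_add_distrib,
      ← Finset.mul_sum, Finset.sum_sub_distrib]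
  have hdiff : ∀ k, DifferentiableAt ℝ
      (fun y => (1 / 2) * (Bs y k ^ 2 - α ^ 2 * lapS (fun z => Bs z k ^ 2) y)
            + (α ^ 2 / 2) * ∑ j, pd j (fun z => Bs z k) y ^ 2) x := fun k =>
    differentiableAt_of_smooth
      ((contDiff_const.mul ((hu2 k).sub (contDiff_const.mul (contDiff_lapS (hu2 k))))).add
        (contDiff_const.mul (ContDiff.sum fun j _ => (contDiff_pd (hu k) j).pow 2))) x
  have hdiv : divM (fun y => (grad Bs y)ᵀ * grad Bs y) x i
      = ∑ k, ∑ j, pd j (fun y => pd i (fun z => Bs z k) y * pd j (fun z => Bs z k) y) x := by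
    rw [Finset.sum_comm]
    simp only [divM, grad, Matrix.mul_apply, Matrix.transpose_apply, Matrix.of_apply]
    refine Finset.sum_congr rfl fun j _ => pd_sum (fun k => ?_) j
    exact differentiableAt_of_smooth ((contDiff_pd (hu k) i).mul (contDiff_pd (hu k) j)) x
  rw [hdiv, gradS, hpotential, pd_sum hdiff, gradTvec, ← Finset.sum_sub_distrib, Finset.mul_sum]
  exact Finset.sum_congr rfl fun k _ => pd_helmS_mul_sub α (hu k) x i
end
end

section
/- (Monotone energy dissipation for LAMHD-α.) Let u_s, B_s, π solve the LAMHD-α system with viscosity ν ≥ 0 and diffusivity η ≥ 0 on an open time interval I, and suppose there is a compact set K ⊂ ℝ³ such that for every t ∈ I the fields u_s(t,·), B_s(t,·) and π(t,·) are supported in K. Then the energy E(t) = ½ ∫_{ℝ³} ( u_s·u + B_s·B ) dx is nonnegative and nonincreasing on I: for all t₁, t₂ ∈ I with t₁ ≤ t₂ one has E(t₂) ≤ E(t₁). -/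
open Matrix MeasureTheory

noncomputable section

/-- Spatial tslice at time `t` of a time-dependent vector field. -/
def tslice (f : ℝ × V3 → V3) (t : ℝ) : V3 → V3 := fun x => f (t, x)

/-- Directional derivative of a scalar space-time field. -/
def dirD (v : ℝ × V3) (F : ℝ × V3 → ℝ) (p : ℝ × V3) : ℝ := fderiv ℝ F p v

/-- Time derivative of a space-time field. -/
abbrev dtime : (ℝ × V3 → ℝ) → ℝ × V3 → ℝ := dirD (1, 0)

/-- Space derivative of a space-time field. -/
abbrev dspace (j : Fin 3) : (ℝ × V3 → ℝ) → ℝ × V3 → ℝ := dirD (0, Pi.single j 1)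

/-- Spatial Laplacian of a space-time field. -/
def lapST (F : ℝ × V3 → ℝ) (p : ℝ × V3) : ℝ := ∑ j, dspace j (dspace j F) p

/-- Spatial Helmholtz operator on space-time fields. -/
def helmST (α : ℝ) (F : ℝ × V3 → ℝ) (p : ℝ × V3) : ℝ := F p - α ^ 2 * lapST F p

/-- Integral of a space-time field over the time slice `t`. -/
def sliceInt (t : ℝ) (F : ℝ × V3 → ℝ) : ℝ := ∫ x : V3, F (t, x)

section Smooth

variable {F G : ℝ × V3 → ℝ} {v w p : ℝ × V3}

lemma ContDiff.dirD (hF : ContDiff ℝ (⊤ : ℕ∞) F) (v : ℝ × V3) :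
    ContDiff ℝ (⊤ : ℕ∞) (dirD v F) :=
  (hF.fderiv_right (m := (⊤ : ℕ∞)) (by simp)).clm_apply contDiff_const

lemma ContDiff.lapST (hF : ContDiff ℝ (⊤ : ℕ∞) F) : ContDiff ℝ (⊤ : ℕ∞) (lapST F) :=
  ContDiff.sum fun j _ => (hF.dirD (0, Pi.single j 1)).dirD (0, Pi.single j 1)

lemma ContDiff.differentiableAt_top (hF : ContDiff ℝ (⊤ : ℕ∞) F) : DifferentiableAt ℝ F p :=
  (hF.differentiable (by simp)) p

lemma dirD_comm (hF : ContDiff ℝ (⊤ : ℕ∞) F) : dirD v (dirD w F) = dirD w (dirD v F) := by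
  funext p
  have hd : DifferentiableAt ℝ (fderiv ℝ F) p :=
    ((hF.fderiv_right (m := (⊤ : ℕ∞)) (by simp)).differentiable (by simp)) p
  have key : ∀ a b : ℝ × V3, dirD a (dirD b F) p = fderiv ℝ (fderiv ℝ F) p a b := by
    intro a b
    have h := (hd.hasFDerivAt.clm_apply (hasFDerivAt_const b p)).fderiv
    change fderiv ℝ (fun q => fderiv ℝ F q b) p a = _
    rw [h]
    simp
  have hsymm : IsSymmSndFDerivAt ℝ F p :=
    hF.contDiffAt.isSymmSndFDerivAt (by
      rw [minSmoothness_of_isRCLikeNormedField]; exact WithTop.coe_le_coe.2 le_top)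
  rw [key, key, hsymm]

lemma dirD_sub (hF : ContDiff ℝ (⊤ : ℕ∞) F) (hG : ContDiff ℝ (⊤ : ℕ∞) G) :
    dirD v (fun q => F q - G q) p = dirD v F p - dirD v G p := by
  unfold dirD
  rw [fderiv_fun_sub hF.differentiableAt_top hG.differentiableAt_top]
  rfl

lemma dirD_const_mul (c : ℝ) (hF : ContDiff ℝ (⊤ : ℕ∞) F) :
    dirD v (fun q => c * F q) p = c * dirD v F p := by
  unfold dirD
  rw [fderiv_const_mul hF.differentiableAt_top]
  rfl

lemma dirD_mul (hF : ContDiff ℝ (⊤ : ℕ∞) F) (hG : ContDiff ℝ (⊤ : ℕ∞) G) :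
    dirD v (fun q => F q * G q) p = F p * dirD v G p + dirD v F p * G p := by
  unfold dirD
  rw [fderiv_fun_mul hF.differentiableAt_top hG.differentiableAt_top]
  simp [mul_comm]

lemma dirD_sum {F : Fin 3 → ℝ × V3 → ℝ} (hF : ∀ i, ContDiff ℝ (⊤ : ℕ∞) (F i)) :
    dirD v (fun q => ∑ i, F i q) p = ∑ i, dirD v (F i) p := by
  unfold dirD
  rw [fderiv_fun_sum fun i _ => (hF i).differentiableAt_top]
  simp

lemma dirD_lapST (hF : ContDiff ℝ (⊤ : ℕ∞) F) : dirD v (lapST F) p = lapST (dirD v F) p := by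
  unfold lapST
  rw [dirD_sum fun j => (hF.dirD _).dirD _]
  refine Finset.sum_congr rfl fun j _ => ?_
  rw [dirD_comm (hF.dirD _), dirD_comm hF]

lemma dirD_helmST (α : ℝ) (hF : ContDiff ℝ (⊤ : ℕ∞) F) :
    dirD v (helmST α F) p = helmST α (dirD v F) p := by
  unfold helmST
  rw [dirD_sub hF (contDiff_const.mul hF.lapST), dirD_const_mul _ hF.lapST, dirD_lapST hF]

lemma pd_slice (hF : ContDiff ℝ (⊤ : ℕ∞) F) (j : Fin 3) (t : ℝ) (x : V3) :
    pd j (fun y => F (t, y)) x = dspace j F (t, x) := by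
  have h := (hF.differentiableAt_top (p := (t, x))).hasFDerivAt.comp x
    ((hasFDerivAt_const t x).prodMk (hasFDerivAt_id x))
  unfold pd dspace dirD
  rw [show (fun y => F (t, y)) = F ∘ fun y => (t, y) from rfl]
  erw [h.fderiv]
  simp

lemma hasDerivAt_slice (hF : ContDiff ℝ (⊤ : ℕ∞) F) (t : ℝ) (x : V3) :
    HasDerivAt (fun s => F (s, x)) (dtime F (t, x)) t :=
  (hF.differentiableAt_top (p := (t, x))).hasFDerivAt.comp_hasDerivAt t
    ((hasDerivAt_id t).prodMk (hasDerivAt_const t x))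

lemma lapS_slice (hF : ContDiff ℝ (⊤ : ℕ∞) F) (t : ℝ) (x : V3) :
    lapS (fun y => F (t, y)) x = lapST F (t, x) := by
  unfold lapS lapST
  refine Finset.sum_congr rfl fun j _ => ?_
  simp_rw [pd_slice hF]
  exact pd_slice (hF.dirD _) j t x

lemma helm_tslice (α : ℝ) {f : ℝ × V3 → V3} (hf : ∀ i, ContDiff ℝ (⊤ : ℕ∞) fun p => f p i)
    (t : ℝ) (x : V3) (i : Fin 3) :
    helm α (tslice f t) x i = helmST α (fun p => f p i) (t, x) := by
  unfold helm helmST lap tslice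
  rw [← lapS_slice (hf i)]

end Smooth

/-- Smooth space-time fields which, for times in `I`, are supported in `K`. -/
structure SuppField (I : Set ℝ) (K : Set V3) (F : ℝ × V3 → ℝ) : Prop where
  smooth : ContDiff ℝ (⊤ : ℕ∞) F
  eq_zero : ∀ t ∈ I, ∀ x, x ∉ K → F (t, x) = 0

namespace SuppField

variable {I : Set ℝ} {K : Set V3} {F G : ℝ × V3 → ℝ} {t : ℝ}

lemma add (hF : SuppField I K F) (hG : SuppField I K G) : SuppField I K fun p => F p + G p :=
  ⟨hF.smooth.add hG.smooth, fun t ht x hx => by simp [hF.eq_zero t ht x hx, hG.eq_zero t ht x hx]⟩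

lemma sub (hF : SuppField I K F) (hG : SuppField I K G) : SuppField I K fun p => F p - G p :=
  ⟨hF.smooth.sub hG.smooth, fun t ht x hx => by simp [hF.eq_zero t ht x hx, hG.eq_zero t ht x hx]⟩

lemma mul (hF : SuppField I K F) (hG : SuppField I K G) : SuppField I K fun p => F p * G p :=
  ⟨hF.smooth.mul hG.smooth, fun t ht x hx => by simp [hF.eq_zero t ht x hx]⟩

lemma const_mul (c : ℝ) (hF : SuppField I K F) : SuppField I K fun p => c * F p :=
  ⟨contDiff_const.mul hF.smooth, fun t ht x hx => by simp [hF.eq_zero t ht x hx]⟩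

lemma sum {F : Fin 3 → ℝ × V3 → ℝ} (hF : ∀ i, SuppField I K (F i)) :
    SuppField I K fun p => ∑ i, F i p :=
  ⟨ContDiff.sum fun i _ => (hF i).smooth,
    fun t ht x hx => Finset.sum_eq_zero fun i _ => (hF i).eq_zero t ht x hx⟩

lemma dirD (hI : IsOpen I) (hK : IsCompact K) (hF : SuppField I K F) (v : ℝ × V3) :
    SuppField I K (dirD v F) := by
  refine ⟨hF.smooth.dirD v, fun t ht x hx => ?_⟩
  have hopen : IsOpen (I ×ˢ Kᶜ) := hI.prod hK.isClosed.isOpen_compl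
  have hev : F =ᶠ[nhds (t, x)] fun _ => 0 :=
    Filter.eventuallyEq_of_mem (hopen.mem_nhds ⟨ht, hx⟩) fun p hp => hF.eq_zero p.1 hp.1 p.2 hp.2
  unfold _root_.dirD
  rw [hev.fderiv_eq]
  simp

lemma lapST (hI : IsOpen I) (hK : IsCompact K) (hF : SuppField I K F) :
    SuppField I K (lapST F) :=
  sum fun j => (hF.dirD hI hK (0, Pi.single j 1)).dirD hI hK (0, Pi.single j 1)

lemma helmST (hI : IsOpen I) (hK : IsCompact K) (α : ℝ) (hF : SuppField I K F) :
    SuppField I K (helmST α F) :=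
  hF.sub ((hF.lapST hI hK).const_mul _)

lemma continuous_slice (hF : SuppField I K F) (t : ℝ) : Continuous fun x => F (t, x) :=
  hF.smooth.continuous.comp (by fun_prop)

lemma integrable (hK : IsCompact K) (ht : t ∈ I) (hF : SuppField I K F) :
    Integrable fun x : V3 => F (t, x) :=
  (hF.continuous_slice t).integrable_of_hasCompactSupport
    (HasCompactSupport.intro hK fun x hx => hF.eq_zero t ht x hx)

lemma sliceInt_add (hK : IsCompact K) (ht : t ∈ I) (hF : SuppField I K F) (hG : SuppField I K G) :
    sliceInt t (fun p => F p + G p) = sliceInt t F + sliceInt t G :=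
  integral_add (hF.integrable hK ht) (hG.integrable hK ht)

lemma sliceInt_sub (hK : IsCompact K) (ht : t ∈ I) (hF : SuppField I K F) (hG : SuppField I K G) :
    sliceInt t (fun p => F p - G p) = sliceInt t F - sliceInt t G :=
  integral_sub (hF.integrable hK ht) (hG.integrable hK ht)

lemma sliceInt_sum (hK : IsCompact K) (ht : t ∈ I) {F : Fin 3 → ℝ × V3 → ℝ}
    (hF : ∀ i, SuppField I K (F i)) :
    sliceInt t (fun p => ∑ i, F i p) = ∑ i, sliceInt t (F i) :=
  integral_finsetSum _ fun i _ => (hF i).integrable hK ht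

end SuppField

lemma sliceInt_const_mul (t c : ℝ) (F : ℝ × V3 → ℝ) :
    sliceInt t (fun p => c * F p) = c * sliceInt t F :=
  integral_const_mul _ _

lemma sliceInt_congr {t : ℝ} {F G : ℝ × V3 → ℝ} (h : ∀ x, F (t, x) = G (t, x)) :
    sliceInt t F = sliceInt t G :=
  integral_congr_ae (Filter.Eventually.of_forall h)

lemma sliceInt_nonneg {t : ℝ} {F : ℝ × V3 → ℝ} (h : ∀ x, 0 ≤ F (t, x)) : 0 ≤ sliceInt t F :=
  integral_nonneg h

namespace SuppField

variable {I : Set ℝ} {K : Set V3} {F G : ℝ × V3 → ℝ} {t : ℝ}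

lemma sliceInt_dspace (hI : IsOpen I) (hK : IsCompact K) (ht : t ∈ I) (hF : SuppField I K F)
    (j : Fin 3) : sliceInt t (dspace j F) = 0 := by
  have hd : (fun x => dspace j F (t, x)) =
      fun x => fderiv ℝ (fun y => F (t, y)) x (Pi.single j 1) :=
    funext fun x => (pd_slice hF.smooth j t x).symm
  have hint := (hF.dirD hI hK (0, Pi.single j 1)).integrable hK ht
  have hdiff : Differentiable ℝ fun y : V3 => F (t, y) :=
    (hF.smooth.differentiable (by simp)).comp (by fun_prop)
  have h := integral_mul_fderiv_eq_neg_fderiv_mul_of_integrable (μ := (volume : Measure V3))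
    (f := fun _ : V3 => (1 : ℝ)) (g := fun y => F (t, y)) (v := Pi.single j 1)
    (by simp) (by simpa [← hd] using hint) (by simpa using hF.integrable hK ht)
    (fun _ _ => differentiableAt_const _) (fun x _ => hdiff x)
  unfold sliceInt
  rw [hd]
  simpa using h

lemma sliceInt_mul_dspace (hI : IsOpen I) (hK : IsCompact K) (ht : t ∈ I)
    (hF : SuppField I K F) (hG : SuppField I K G) (j : Fin 3) :
    sliceInt t (fun p => F p * dspace j G p) = -sliceInt t (fun p => dspace j F p * G p) := by
  have h := (hF.mul hG).sliceInt_dspace hI hK ht j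
  rw [sliceInt_congr (G := fun p => F p * dspace j G p + dspace j F p * G p)
      fun x => dirD_mul hF.smooth hG.smooth,
    sliceInt_add hK ht (hF.mul (hG.dirD hI hK _)) ((hF.dirD hI hK _).mul hG)] at h
  linarith

lemma sliceInt_mul_lapST (hI : IsOpen I) (hK : IsCompact K) (ht : t ∈ I)
    (hF : SuppField I K F) (hG : SuppField I K G) :
    sliceInt t (fun p => F p * _root_.lapST G p) =
      -∑ j, sliceInt t (fun p => dspace j F p * dspace j G p) := by
  unfold _root_.lapST
  simp_rw [Finset.mul_sum]
  rw [sliceInt_sum hK ht fun j => hF.mul ((hG.dirD hI hK _).dirD hI hK _),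
    ← Finset.sum_neg_distrib]
  exact Finset.sum_congr rfl fun j _ => hF.sliceInt_mul_dspace hI hK ht (hG.dirD hI hK _) j

lemma sliceInt_lapST_symm (hI : IsOpen I) (hK : IsCompact K) (ht : t ∈ I)
    (hF : SuppField I K F) (hG : SuppField I K G) :
    sliceInt t (fun p => F p * _root_.lapST G p) =
      sliceInt t (fun p => G p * _root_.lapST F p) := by
  rw [hF.sliceInt_mul_lapST hI hK ht hG, hG.sliceInt_mul_lapST hI hK ht hF]
  simp_rw [mul_comm]

lemma sliceInt_mul_lapST_self_nonpos (hI : IsOpen I) (hK : IsCompact K) (ht : t ∈ I)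
    (hF : SuppField I K F) : sliceInt t (fun p => F p * _root_.lapST F p) ≤ 0 := by
  rw [hF.sliceInt_mul_lapST hI hK ht hF, neg_nonpos]
  exact Finset.sum_nonneg fun j _ => sliceInt_nonneg fun x => mul_self_nonneg _

lemma sliceInt_mul_helmST (hI : IsOpen I) (hK : IsCompact K) (ht : t ∈ I) (α : ℝ)
    (hF : SuppField I K F) (hG : SuppField I K G) :
    sliceInt t (fun p => F p * _root_.helmST α G p) =
      sliceInt t (fun p => F p * G p) - α ^ 2 * sliceInt t (fun p => F p * _root_.lapST G p) := by
  rw [← sliceInt_const_mul, ← sliceInt_sub hK ht (hF.mul hG)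
    ((hF.mul (hG.lapST hI hK)).const_mul _)]
  refine sliceInt_congr fun x => ?_
  unfold _root_.helmST
  ring

lemma sliceInt_helmST_symm (hI : IsOpen I) (hK : IsCompact K) (ht : t ∈ I) (α : ℝ)
    (hF : SuppField I K F) (hG : SuppField I K G) :
    sliceInt t (fun p => F p * _root_.helmST α G p) =
      sliceInt t (fun p => G p * _root_.helmST α F p) := by
  rw [hF.sliceInt_mul_helmST hI hK ht α hG, hG.sliceInt_mul_helmST hI hK ht α hF,
    hF.sliceInt_lapST_symm hI hK ht hG]
  simp_rw [mul_comm (F _) (G _)]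

lemma sliceInt_mul_helmST_self_nonneg (hI : IsOpen I) (hK : IsCompact K) (ht : t ∈ I) (α : ℝ)
    (hF : SuppField I K F) : 0 ≤ sliceInt t (fun p => F p * _root_.helmST α F p) := by
  rw [hF.sliceInt_mul_helmST hI hK ht α hF]
  have h1 : 0 ≤ sliceInt t (fun p => F p * F p) := sliceInt_nonneg fun x => mul_self_nonneg _
  nlinarith [sq_nonneg α, hF.sliceInt_mul_lapST_self_nonpos hI hK ht]

lemma sliceInt_mul_lapST_helmST_nonpos (hI : IsOpen I) (hK : IsCompact K) (ht : t ∈ I) (α : ℝ)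
    (hF : SuppField I K F) :
    sliceInt t (fun p => F p * _root_.lapST (_root_.helmST α F) p) ≤ 0 := by
  have hL := hF.lapST hI hK
  rw [hF.sliceInt_lapST_symm hI hK ht (hF.helmST hI hK α)]
  simp_rw [mul_comm (_root_.helmST α F _)]
  rw [hL.sliceInt_mul_helmST hI hK ht α hF]
  simp_rw [mul_comm (_root_.lapST F _) (F _)]
  have h1 : 0 ≤ sliceInt t (fun p => _root_.lapST F p * _root_.lapST F p) :=
    sliceInt_nonneg fun x => mul_self_nonneg _
  nlinarith [sq_nonneg α, hF.sliceInt_mul_lapST_self_nonpos hI hK ht]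

lemma sliceInt_transport (hI : IsOpen I) (hK : IsCompact K) (ht : t ∈ I)
    {U : Fin 3 → ℝ × V3 → ℝ} (hU : ∀ i, SuppField I K (U i))
    (hdiv : ∀ x, ∑ j, dspace j (U j) (t, x) = 0) (hF : SuppField I K F) :
    sliceInt t (fun p => ∑ j, U j p * dspace j F p) = 0 := by
  have h : sliceInt t (fun p => ∑ j, dspace j (fun q => U j q * F q) p) = 0 := by
    rw [sliceInt_sum hK ht fun j => ((hU j).mul hF).dirD hI hK _]
    exact Finset.sum_eq_zero fun j _ => ((hU j).mul hF).sliceInt_dspace hI hK ht j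
  rw [← h]
  refine sliceInt_congr fun x => ?_
  simp_rw [dspace, dirD_mul (hU _).smooth hF.smooth, Finset.sum_add_distrib, ← Finset.sum_mul]
  rw [hdiv x]
  ring

lemma hasDerivAt_sliceInt (hI : IsOpen I) (hK : IsCompact K) (ht : t ∈ I)
    (hF : SuppField I K F) :
    HasDerivAt (fun s => sliceInt s F) (sliceInt t (dtime F)) t := by
  have hdF := hF.dirD hI hK (1, 0)
  obtain ⟨ε, hε, hball⟩ := Metric.nhds_basis_closedBall.mem_iff.1 (hI.mem_nhds ht)
  obtain ⟨C, hC⟩ := ((isCompact_closedBall t ε).prod hK).exists_bound_of_continuousOn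
    hdF.smooth.continuous.continuousOn
  refine (hasDerivAt_integral_of_dominated_loc_of_deriv_le (μ := (volume : Measure V3))
    (F := fun s x => F (s, x)) (F' := fun s x => dtime F (s, x))
    (bound := K.indicator fun _ => C) (Metric.closedBall_mem_nhds t hε)
    (Filter.Eventually.of_forall fun s => (hF.continuous_slice s).aestronglyMeasurable)
    (hF.integrable hK ht) (hdF.continuous_slice t).aestronglyMeasurable
    (Filter.Eventually.of_forall fun x s hs => ?_) ?_
    (Filter.Eventually.of_forall fun x s _ => hasDerivAt_slice hF.smooth s x)).2
  · by_cases hx : x ∈ K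
    · simpa [hx] using hC (s, x) ⟨hs, hx⟩
    · simp [hx, hdF.eq_zero s (hball hs) x hx]
  · exact (integrable_indicator_iff hK.measurableSet).2
      (integrableOn_const hK.measure_lt_top.ne)

end SuppField

/-- Twice the energy density. -/
def energyDensity (α : ℝ) (U B : Fin 3 → ℝ × V3 → ℝ) (p : ℝ × V3) : ℝ :=
  ∑ i, (U i p * helmST α (U i) p + B i p * helmST α (B i) p)

section Energy

variable {I : Set ℝ} {K : Set V3} {U B : Fin 3 → ℝ × V3 → ℝ} {P : ℝ × V3 → ℝ} {t : ℝ}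

lemma SuppField.energyDensity (hI : IsOpen I) (hK : IsCompact K) (α : ℝ)
    (hU : ∀ i, SuppField I K (U i)) (hB : ∀ i, SuppField I K (B i)) :
    SuppField I K (energyDensity α U B) :=
  sum fun i => ((hU i).mul ((hU i).helmST hI hK α)).add ((hB i).mul ((hB i).helmST hI hK α))

lemma sliceInt_energyDensity_nonneg (hI : IsOpen I) (hK : IsCompact K) (ht : t ∈ I) (α : ℝ)
    (hU : ∀ i, SuppField I K (U i)) (hB : ∀ i, SuppField I K (B i)) :
    0 ≤ sliceInt t (energyDensity α U B) := by
  have h1 := fun i => (hU i).mul ((hU i).helmST hI hK α)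
  have h2 := fun i => (hB i).mul ((hB i).helmST hI hK α)
  unfold energyDensity
  rw [SuppField.sliceInt_sum hK ht fun i => (h1 i).add (h2 i)]
  refine Finset.sum_nonneg fun i _ => ?_
  rw [(h1 i).sliceInt_add hK ht (h2 i)]
  exact add_nonneg ((hU i).sliceInt_mul_helmST_self_nonneg hI hK ht α)
    ((hB i).sliceInt_mul_helmST_self_nonneg hI hK ht α)

/-- Self-adjointness of the Helmholtz operator puts the energy production in the form in which
the evolution equations apply. -/
lemma sliceInt_dtime_energyDensity (hI : IsOpen I) (hK : IsCompact K) (ht : t ∈ I) (α : ℝ)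
    (hU : ∀ i, SuppField I K (U i)) (hB : ∀ i, SuppField I K (B i)) :
    sliceInt t (dtime (energyDensity α U B)) =
      2 * sliceInt t (fun p => ∑ i,
        (U i p * dtime (helmST α (U i)) p + dtime (B i) p * helmST α (B i) p)) := by
  have hdU := fun i => (hU i).dirD hI hK (1, 0)
  have hdB := fun i => (hB i).dirD hI hK (1, 0)
  have hV := fun i => (hU i).helmST hI hK α
  have hC := fun i => (hB i).helmST hI hK α
  have hdV := fun i => (hV i).dirD hI hK (1, 0)
  have hdC := fun i => (hC i).dirD hI hK (1, 0)
  have e1 : ∀ i, sliceInt t (fun p => dtime (U i) p * helmST α (U i) p) =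
      sliceInt t (fun p => U i p * dtime (helmST α (U i)) p) := fun i => by
    rw [(hdU i).sliceInt_helmST_symm hI hK ht α (hU i)]
    exact sliceInt_congr fun x => by rw [dtime, dirD_helmST α (hU i).smooth]
  have e2 : ∀ i, sliceInt t (fun p => B i p * dtime (helmST α (B i)) p) =
      sliceInt t (fun p => dtime (B i) p * helmST α (B i) p) := fun i => by
    rw [(hdB i).sliceInt_helmST_symm hI hK ht α (hB i)]
    exact sliceInt_congr fun x => by rw [dtime, dirD_helmST α (hB i).smooth]
  have e3 : ∀ x, dtime (energyDensity α U B) (t, x) =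
      ∑ i, ((U i (t, x) * dtime (helmST α (U i)) (t, x)
        + dtime (U i) (t, x) * helmST α (U i) (t, x))
        + (B i (t, x) * dtime (helmST α (B i)) (t, x)
        + dtime (B i) (t, x) * helmST α (B i) (t, x))) := fun x => by
    unfold energyDensity
    have h1 := fun i => (hU i).mul (hV i)
    have h2 := fun i => (hB i).mul (hC i)
    rw [dtime, dirD_sum fun i => ((h1 i).add (h2 i)).smooth]
    refine Finset.sum_congr rfl fun i _ => ?_
    rw [← dirD_mul (hU i).smooth (hV i).smooth, ← dirD_mul (hB i).smooth (hC i).smooth]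
    unfold dirD
    rw [fderiv_fun_add (h1 i).smooth.differentiableAt_top (h2 i).smooth.differentiableAt_top]
    rfl
  have a1 := fun i => (hU i).mul (hdV i)
  have a2 := fun i => (hdU i).mul (hV i)
  have a3 := fun i => (hB i).mul (hdC i)
  have a4 := fun i => (hdB i).mul (hC i)
  rw [sliceInt_congr (G := fun p => ∑ i, ((U i p * dtime (helmST α (U i)) p
        + dtime (U i) p * helmST α (U i) p) + (B i p * dtime (helmST α (B i)) p
        + dtime (B i) p * helmST α (B i) p))) e3,
    SuppField.sliceInt_sum hK ht fun i => ((a1 i).add (a2 i)).add ((a3 i).add (a4 i)),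
    SuppField.sliceInt_sum hK ht fun i => (a1 i).add (a4 i), Finset.mul_sum]
  refine Finset.sum_congr rfl fun i _ => ?_
  rw [((a1 i).add (a2 i)).sliceInt_add hK ht ((a3 i).add (a4 i)),
    (a1 i).sliceInt_add hK ht (a2 i), (a3 i).sliceInt_add hK ht (a4 i),
    (a1 i).sliceInt_add hK ht (a4 i), e1, e2]
  ring

lemma sliceInt_dtime_energyDensity_nonpos (hI : IsOpen I) (hK : IsCompact K) (ht : t ∈ I)
    {α ν η : ℝ} (hν : 0 ≤ ν) (hη : 0 ≤ η)
    (hU : ∀ i, SuppField I K (U i)) (hB : ∀ i, SuppField I K (B i)) (hP : SuppField I K P)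
    (hdivU : ∀ x, ∑ j, dspace j (U j) (t, x) = 0)
    (hdivB : ∀ x, ∑ j, dspace j (B j) (t, x) = 0)
    (hmotion : ∀ x i, dtime (helmST α (U i)) (t, x)
      + ∑ j, U j (t, x) * dspace j (helmST α (U i)) (t, x)
      - ∑ j, B j (t, x) * dspace j (helmST α (B i)) (t, x)
      + ∑ j, dspace i (U j) (t, x) * helmST α (U j) (t, x)
      + ∑ j, dspace i (helmST α (B j)) (t, x) * B j (t, x)
      + dspace i P (t, x) = ν * lapST (helmST α (U i)) (t, x))
    (hinduction : ∀ x i, dtime (B i) (t, x)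
      + ∑ j, U j (t, x) * dspace j (B i) (t, x)
      - ∑ j, B j (t, x) * dspace j (U i) (t, x) = η * lapST (helmST α (B i)) (t, x)) :
    sliceInt t (dtime (energyDensity α U B)) ≤ 0 := by
  have hV := fun i => (hU i).helmST hI hK α
  have hC := fun i => (hB i).helmST hI hK α
  have sUV := SuppField.sum fun i => (hU i).mul (hV i)
  have sUC := SuppField.sum fun i => (hU i).mul (hC i)
  have sCB := SuppField.sum fun i => (hC i).mul (hB i)
  have hT : ∀ {W : Fin 3 → ℝ × V3 → ℝ} {Q : ℝ × V3 → ℝ}, (∀ i, SuppField I K (W i)) →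
      SuppField I K Q → SuppField I K fun p => ∑ j, W j p * dspace j Q p :=
    fun hW hQ => SuppField.sum fun j => (hW j).mul (hQ.dirD hI hK _)
  have d1 := fun i => ((hU i).mul ((hV i).lapST hI hK)).const_mul ν
  have d2 := fun i => ((hC i).mul ((hC i).lapST hI hK)).const_mul η
  have hD := SuppField.sum fun i => (d1 i).add (d2 i)
  have hpt : ∀ x, ∑ i, (U i (t, x) * dtime (helmST α (U i)) (t, x)
        + dtime (B i) (t, x) * helmST α (B i) (t, x)) =
      ((((∑ i, (ν * (U i (t, x) * lapST (helmST α (U i)) (t, x))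
        + η * (helmST α (B i) (t, x) * lapST (helmST α (B i)) (t, x))))
      - ∑ j, U j (t, x) * dspace j (fun q => ∑ i, U i q * helmST α (U i) q) (t, x))
      + ∑ j, B j (t, x) * dspace j (fun q => ∑ i, U i q * helmST α (B i) q) (t, x))
      - ∑ j, U j (t, x) * dspace j (fun q => ∑ i, helmST α (B i) q * B i q) (t, x))
      - ∑ j, U j (t, x) * dspace j P (t, x) := by
    intro x
    simp_rw [dspace, dirD_sum fun i => ((hU i).mul (hV i)).smooth,
      dirD_sum fun i => ((hU i).mul (hC i)).smooth, dirD_sum fun i => ((hC i).mul (hB i)).smooth,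
      dirD_mul (hU _).smooth (hV _).smooth, dirD_mul (hU _).smooth (hC _).smooth,
      dirD_mul (hC _).smooth (hB _).smooth]
    have m := hmotion x
    have n := hinduction x
    simp only [Fin.sum_univ_three, dspace] at m n ⊢
    linear_combination U 0 (t, x) * m 0 + U 1 (t, x) * m 1 + U 2 (t, x) * m 2
      + helmST α (B 0) (t, x) * n 0 + helmST α (B 1) (t, x) * n 1 + helmST α (B 2) (t, x) * n 2
  have hdiss : sliceInt t (fun p => ∑ i, (ν * (U i p * lapST (helmST α (U i)) p)
      + η * (helmST α (B i) p * lapST (helmST α (B i)) p))) ≤ 0 := by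
    rw [SuppField.sliceInt_sum hK ht fun i => (d1 i).add (d2 i)]
    refine Finset.sum_nonpos fun i _ => ?_
    rw [(d1 i).sliceInt_add hK ht (d2 i), sliceInt_const_mul, sliceInt_const_mul]
    exact add_nonpos
      (mul_nonpos_of_nonneg_of_nonpos hν ((hU i).sliceInt_mul_lapST_helmST_nonpos hI hK ht α))
      (mul_nonpos_of_nonneg_of_nonpos hη ((hC i).sliceInt_mul_lapST_self_nonpos hI hK ht))
  rw [sliceInt_dtime_energyDensity hI hK ht α hU hB, sliceInt_congr (G := fun p =>
      ((((∑ i, (ν * (U i p * lapST (helmST α (U i)) p)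
        + η * (helmST α (B i) p * lapST (helmST α (B i)) p)))
      - ∑ j, U j p * dspace j (fun q => ∑ i, U i q * helmST α (U i) q) p)
      + ∑ j, B j p * dspace j (fun q => ∑ i, U i q * helmST α (B i) q) p)
      - ∑ j, U j p * dspace j (fun q => ∑ i, helmST α (B i) q * B i q) p)
      - ∑ j, U j p * dspace j P p) hpt,
    (((hD.sub (hT hU sUV)).add (hT hB sUC)).sub (hT hU sCB)).sliceInt_sub hK ht (hT hU hP),
    ((hD.sub (hT hU sUV)).add (hT hB sUC)).sliceInt_sub hK ht (hT hU sCB),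
    (hD.sub (hT hU sUV)).sliceInt_add hK ht (hT hB sUC), hD.sliceInt_sub hK ht (hT hU sUV),
    sUV.sliceInt_transport hI hK ht hU hdivU, sUC.sliceInt_transport hI hK ht hB hdivB,
    sCB.sliceInt_transport hI hK ht hU hdivU, hP.sliceInt_transport hI hK ht hU hdivU]
  linarith

end Energy

/-- monotone energy dissipation for LAMHD-α.  For compactly supported
solutions with `ν ≥ 0`, `η ≥ 0`, the energy `E(t) = ½ ∫ (u_s·u + B_s·B) dx` is
nonnegative and nonincreasing. -/
theorem lamhd_energy_monotone (α : ℝ) (hα : 0 ≤ α) (ν η : ℝ) (hν : 0 ≤ ν) (hη : 0 ≤ η)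
    (I : Set ℝ) (hIopen : IsOpen I) (hIconn : I.OrdConnected) (us Bs : ℝ × V3 → V3) (pres : ℝ × V3 → ℝ)
    (hus : ContDiff ℝ (⊤ : ℕ∞) us) (hBs : ContDiff ℝ (⊤ : ℕ∞) Bs) (hpres : ContDiff ℝ (⊤ : ℕ∞) pres)
    (hdivu : ∀ t ∈ I, ∀ x : V3, divV (tslice us t) x = 0)
    (hdivB : ∀ t ∈ I, ∀ x : V3, divV (tslice Bs t) x = 0)
    (hmotion : ∀ t ∈ I, ∀ x : V3, ∀ i : Fin 3,
      deriv (fun s => helm α (tslice us s) x i) t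
        + advect (tslice us t) (helm α (tslice us t)) x i
        - advect (tslice Bs t) (helm α (tslice Bs t)) x i
        + gradTvec (tslice us t) (helm α (tslice us t)) x i
        + gradTvec (helm α (tslice Bs t)) (tslice Bs t) x i
        + gradS (fun y => pres (t, y)) x i
        = ν * lap (helm α (tslice us t)) x i)
    (hinduction : ∀ t ∈ I, ∀ x : V3, ∀ i : Fin 3,
      deriv (fun s => Bs (s, x) i) t
        + advect (tslice us t) (tslice Bs t) x i
        - advect (tslice Bs t) (tslice us t) x i
        = η * lap (helm α (tslice Bs t)) x i)
    (K : Set V3) (hK : IsCompact K)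
    (hsupp : ∀ t ∈ I, ∀ x : V3, x ∉ K →
      us (t, x) = 0 ∧ Bs (t, x) = 0 ∧ pres (t, x) = 0) :
    (∀ t ∈ I,
      0 ≤ (1 / 2 : ℝ) * ∫ x : V3, (∑ i, us (t, x) i * helm α (tslice us t) x i
          + ∑ i, Bs (t, x) i * helm α (tslice Bs t) x i)) ∧
    (∀ t₁ ∈ I, ∀ t₂ ∈ I, t₁ ≤ t₂ →
      (1 / 2 : ℝ) * ∫ x : V3, (∑ i, us (t₂, x) i * helm α (tslice us t₂) x i
          + ∑ i, Bs (t₂, x) i * helm α (tslice Bs t₂) x i)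
      ≤ (1 / 2 : ℝ) * ∫ x : V3, (∑ i, us (t₁, x) i * helm α (tslice us t₁) x i
          + ∑ i, Bs (t₁, x) i * helm α (tslice Bs t₁) x i)) := by
  have cU : ∀ i, ContDiff ℝ (⊤ : ℕ∞) fun p => us p i := fun i => contDiff_pi.1 hus i
  have cB : ∀ i, ContDiff ℝ (⊤ : ℕ∞) fun p => Bs p i := fun i => contDiff_pi.1 hBs i
  have hU : ∀ i, SuppField I K fun p => us p i := fun i =>
    ⟨cU i, fun t ht x hx => by simp [(hsupp t ht x hx).1]⟩
  have hB : ∀ i, SuppField I K fun p => Bs p i := fun i =>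
    ⟨cB i, fun t ht x hx => by simp [(hsupp t ht x hx).2.1]⟩
  have hP : SuppField I K pres := ⟨hpres, fun t ht x hx => (hsupp t ht x hx).2.2⟩
  have hV := fun i => ((hU i).helmST hIopen hK α).smooth
  have hC := fun i => ((hB i).helmST hIopen hK α).smooth
  have hE : ∀ t, ∫ x : V3, (∑ i, us (t, x) i * helm α (tslice us t) x i
      + ∑ i, Bs (t, x) i * helm α (tslice Bs t) x i) =
      sliceInt t (energyDensity α (fun i p => us p i) fun i p => Bs p i) := fun t => by
    simp_rw [helm_tslice α cU, helm_tslice α cB, ← Finset.sum_add_distrib]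
    rfl
  have hderiv := fun t (ht : t ∈ I) =>
    (SuppField.energyDensity hIopen hK α hU hB).hasDerivAt_sliceInt hIopen hK ht
  have hanti : AntitoneOn
      (fun t => sliceInt t (energyDensity α (fun i p => us p i) fun i p => Bs p i)) I := by
    refine antitoneOn_of_deriv_nonpos hIconn.convex
      (fun t ht => (hderiv t ht).continuousAt.continuousWithinAt)
      (fun t ht => (hderiv t (interior_subset ht)).differentiableAt.differentiableWithinAt)
      fun t ht => ?_
    have ht := interior_subset ht
    rw [(hderiv t ht).deriv]
    refine sliceInt_dtime_energyDensity_nonpos hIopen hK ht hν hη hU hB hP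
      (fun x => ?_) (fun x => ?_) (fun x i => ?_) fun x i => ?_
    · simpa only [divV, tslice, pd_slice (cU _)] using hdivu t ht x
    · simpa only [divV, tslice, pd_slice (cB _)] using hdivB t ht x
    · have h := hmotion t ht x i
      simp only [advect, gradTvec, gradS, grad, lap, Matrix.transpose_apply, Matrix.of_apply,
        helm_tslice α cU, helm_tslice α cB, pd_slice (hV _), pd_slice (hC _), pd_slice hpres,
        lapS_slice (hV _), (hasDerivAt_slice (hV i) t x).deriv] at h
      simpa only [tslice, pd_slice (cU _)] using h
    · have h := hinduction t ht x i
      simp only [advect, lap, helm_tslice α cB, lapS_slice (hC _),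
        (hasDerivAt_slice (cB i) t x).deriv] at h
      simpa only [tslice, pd_slice (cU _), pd_slice (cB _)] using h
  simp only [hE]
  exact ⟨fun t ht => mul_nonneg (by norm_num)
      (sliceInt_energyDensity_nonneg hIopen hK ht α hU hB),
    fun t₁ h₁ t₂ h₂ h => mul_le_mul_of_nonneg_left (hanti h₁ h₂ h) (by norm_num)⟩
end
end
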